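/- Let π be a mechanism for n agents that is anonymous, efficient, and strategyproof w.r.t. manipulation, replication, and hiding. Suppose there exist an agent i, a tuple D_{−i} of the other agents' reports, reals y0 ≤ y1, and s, h ∈ ℝ with s < y0 ≤ y1 < h, such that for every nonempty finite multiset D_i with med(D_i) = [y0,y1]: π(D_i,D_{−i}) = s if l(s,D_i) < l(h,D_i), π(D_i,D_{−i}) = h if l(s,D_i) > l(h,D_i), and π(D_i,D_{−i}) ∈ {s,h} otherwise. Then, writing [y_j^0, y_j^1] = med(D_j) for every agent j (with [y_i^0,y_i^1] = [y0,y1]), no agent j satisfies (y_j^0 ≤ s and y_j^1 < h), and no agent j satisfies (y_j^1 ≥ h and y_j^0 > s). -/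

import Mathlib

/-- The loss of a finite multiset `S` of reals at a point `x`:
`l(x,S) = \sum_{y \in S} |x - y|` (with multiplicity). -/
noncomputable def loss (x : ℝ) (S : Multiset ℝ) : ℝ :=
  (S.map fun y => |x - y|).sum

/-- Left endpoint `t_{⌈k/2⌉}` of the median interval of a (nonempty) multiset of reals. -/
noncomputable def medLo (S : Multiset ℝ) : ℝ :=
  (S.sort (· ≤ ·)).getD ((S.card - 1) / 2) 0

/-- Right endpoint `t_{⌊k/2⌋+1}` of the median interval of a (nonempty) multiset of reals. -/
noncomputable def medHi (S : Multiset ℝ) : ℝ :=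
  (S.sort (· ≤ ·)).getD (S.card / 2) 0

/-- A mechanism is anonymous if its value is invariant under every permutation of the
agents' reported multisets (on profiles of nonempty multisets). -/
def Anonymous (n : ℕ) (π : (Fin n → Multiset ℝ) → ℝ) : Prop :=
  ∀ D : Fin n → Multiset ℝ, (∀ j, D j ≠ 0) →
    ∀ σ : Equiv.Perm (Fin n), π (D ∘ σ) = π D

/-- A mechanism is strategyproof w.r.t. manipulation, replication and hiding if no agent
can strictly decrease her loss by replacing her report with an arbitrary nonempty
finite multiset. -/
def Strategyproof (n : ℕ) (π : (Fin n → Multiset ℝ) → ℝ) : Prop :=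
  ∀ (i : Fin n) (D : Fin n → Multiset ℝ), (∀ j, D j ≠ 0) →
    ∀ Di' : Multiset ℝ, Di' ≠ 0 →
      loss (π D) (D i) ≤ loss (π (Function.update D i Di')) (D i)

/-- A mechanism is efficient if its output is always Pareto optimal. -/
def Efficient (n : ℕ) (π : (Fin n → Multiset ℝ) → ℝ) : Prop :=
  ∀ D : Fin n → Multiset ℝ, (∀ j, D j ≠ 0) →
    ¬ ∃ x : ℝ, (∀ j, loss x (D j) ≤ loss (π D) (D j)) ∧
        ∃ j, loss x (D j) < loss (π D) (D j)

/-- `g` is strictly decreasing up to `a`, constant on `[a,b]`, strictly increasing from `b`. -/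
def IsMed (g : ℝ → ℝ) (a b : ℝ) : Prop :=
  a ≤ b ∧ (∀ x x', x < x' → x' ≤ a → g x' < g x) ∧
  (∀ x x', a ≤ x → x ≤ b → a ≤ x' → x' ≤ b → g x = g x') ∧
  (∀ x x', b ≤ x → x < x' → g x < g x')

theorem IsMed.neg {g : ℝ → ℝ} {a b : ℝ} (H : IsMed g a b) :
    IsMed (fun x => g (-x)) (-b) (-a) := by
  obtain ⟨h0, h1, h2, h3⟩ := H
  refine ⟨by linarith, fun x x' hx hx' => ?_, fun x x' p q r t => ?_, fun x x' hx hx' => ?_⟩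
  · exact h3 _ _ (by linarith) (by linarith)
  · exact h2 _ _ (by linarith) (by linarith) (by linarith) (by linarith)
  · exact h1 _ _ (by linarith) (by linarith)

theorem IsMed.unique {g : ℝ → ℝ} {a b c d : ℝ} (H : IsMed g a b) (K : IsMed g c d) :
    a = c ∧ b = d := by
  have key : ∀ {a b c d : ℝ}, IsMed g a b → IsMed g c d → a ≤ c ∧ d ≤ b := by
    intro a b c d H K
    obtain ⟨h0, h1, h2, h3⟩ := H
    obtain ⟨k0, k1, k2, k3⟩ := K
    constructor
    · by_contra hlt
      push Not at hlt
      have e1 := h1 c a hlt le_rfl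
      rcases le_total a d with had | had
      · have := k2 c a le_rfl k0 hlt.le had
        linarith
      · have e2 := k2 c d le_rfl k0 k0 le_rfl
        rcases had.lt_or_eq with h | h
        · have := k3 d a le_rfl h
          linarith
        · subst h; linarith
    · by_contra hlt
      push Not at hlt
      have e1 := h3 b d le_rfl hlt
      rcases le_total c b with had | had
      · have := k2 b d had hlt.le k0 le_rfl
        linarith
      · have e2 := k2 c d le_rfl k0 k0 le_rfl
        rcases had.lt_or_eq with h | h
        · have := k1 b c h le_rfl
          linarith
        · subst h; linarith
  have p := key H K
  have q := key K H
  exact ⟨le_antisymm p.1 q.1, le_antisymm q.2 p.2⟩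

theorem step {T : Type*} (l : ℝ → T → ℝ) (ok : T → Prop) (f : T → T → ℝ)
    (hsym : ∀ A B, ok A → ok B → f A B = f B A)
    (hsp : ∀ A B B', ok A → ok B → ok B' → l (f A B) B ≤ l (f A B') B)
    (y0 y1 s h : ℝ) (hs : s < y0) (hh : y1 < h)
    (d : T) (hd : ok d) (hL : ∀ x, s ≤ x → x < h → l x d < l h d)
    (P : ∀ A, ok A → IsMed (fun x => l x A) y0 y1 →
      (l s A < l h A → f A d = s) ∧ (l h A < l s A → f A d = h))
    (fam : ∀ x, s < x → x < h → ∃ A, ok A ∧ IsMed (fun x => l x A) y0 y1 ∧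
      l x A < l h A ∧ l h A < l s A)
    (B : T) (hB : ok B) (mB : IsMed (fun x => l x B) y0 y1) (sB : l s B < l h B) :
    ∀ A, ok A → IsMed (fun x => l x A) y0 y1 →
      (l s A < l h A → f A B = s) ∧ (l h A < l s A → f A B = h) := by
  have pB := (P B hB mB).1 sB
  have low : ∀ A, ok A → IsMed (fun x => l x A) y0 y1 → s ≤ f A B ∧ l (f A B) A ≤ l s A := by
    intro A hA mA
    have e := hsp B A d hB hA hd
    rw [pB, ← hsym A B hA hB] at e
    refine ⟨?_, e⟩
    by_contra hlt
    push Not at hlt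
    have := mA.2.1 _ _ hlt hs.le
    simp only at this
    linarith
  have c1 : ∀ A, ok A → IsMed (fun x => l x A) y0 y1 → l h A < l s A → f A B = h := by
    intro A hA mA sA
    have pA := (P A hA mA).2 sA
    have e1 := (low A hA mA).1
    have e2 := hsp A d B hA hd hB
    have e3 := hsp A B d hA hB hd
    rw [pA] at e2 e3
    apply le_antisymm
    · by_contra hlt
      push Not at hlt
      have := mB.2.2.2 _ _ hh.le hlt
      simp only at this
      linarith
    · by_contra hlt
      push Not at hlt
      have := hL _ e1 hlt
      linarith
  intro A hA mA
  refine ⟨fun sA => ?_, c1 A hA mA⟩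
  obtain ⟨e1, e2⟩ := low A hA mA
  by_contra hne
  have hgt : s < f A B := lt_of_le_of_ne e1 (Ne.symm hne)
  have hlt : f A B < h := by
    by_contra hge
    push Not at hge
    rcases hge.lt_or_eq with hge | hge
    · have := mA.2.2.2 _ _ hh.le hge
      simp only at this
      linarith
    · rw [← hge] at e2; linarith
  obtain ⟨C, hC, mC, q1, q2⟩ := fam _ hgt hlt
  have e3 := hsp B C A hB hC hA
  rw [hsym B C hB hC, hsym B A hB hA, c1 C hC mC q2] at e3
  linarith

theorem loss_add (x : ℝ) (S U : Multiset ℝ) : loss x (S + U) = loss x S + loss x U := by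
  simp [loss]

theorem loss_nsmul (x : ℝ) (N : ℕ) (S : Multiset ℝ) : loss x (N • S) = N * loss x S := by
  induction N with
  | zero => simp [loss]
  | succ k ih => rw [succ_nsmul, loss_add, ih]; push_cast; ring

theorem loss_pair (x p q : ℝ) : loss x {p, q} = |x - p| + |x - q| := by
  simp [loss]

theorem med_pair {a b p q p' q' : ℝ} (hab : a ≤ b) (hp : p ≤ a) (hq : b ≤ q)
    (hp' : p' ≤ a) (hq' : b ≤ q') (M N : ℕ) :
    IsMed (fun x => loss x ({a, b} + M • {p, q} + N • {p', q'})) a b := by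
  have key1 : ∀ {p q x x' : ℝ}, p ≤ a → b ≤ q → x < x' → x' ≤ a →
      loss x' {p, q} ≤ loss x {p, q} := by
    intro p q x x' hp hq hx hx'
    simp only [loss_pair]
    rw [abs_of_nonpos (by linarith : x' - q ≤ 0), abs_of_nonpos (by linarith : x - q ≤ 0)]
    have := abs_sub_abs_le_abs_sub (x' - p) (x - p)
    rw [show x' - p - (x - p) = x' - x by ring, abs_of_pos (by linarith : 0 < x' - x)] at this
    linarith
  have key2 : ∀ {p q x : ℝ}, p ≤ a → b ≤ q → a ≤ x → x ≤ b →
      loss x {p, q} = q - p := by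
    intro p q x hp hq hx hx'
    simp only [loss_pair]
    rw [abs_of_nonpos (by linarith : x - q ≤ 0), abs_of_nonneg (by linarith : 0 ≤ x - p)]
    ring
  have key3 : ∀ {p q x x' : ℝ}, p ≤ a → b ≤ q → b ≤ x → x < x' →
      loss x {p, q} ≤ loss x' {p, q} := by
    intro p q x x' hp hq hx hx'
    simp only [loss_pair]
    rw [abs_of_nonneg (by linarith : 0 ≤ x' - p), abs_of_nonneg (by linarith : 0 ≤ x - p)]
    have := abs_sub_abs_le_abs_sub (x - q) (x' - q)
    rw [show x - q - (x' - q) = -(x' - x) by ring, abs_neg,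
      abs_of_pos (by linarith : 0 < x' - x)] at this
    linarith
  refine ⟨hab, fun x x' hx hx' => ?_, fun x x' h1 h2 h3 h4 => ?_, fun x x' hx hx' => ?_⟩
  · simp only [loss_add, loss_nsmul]
    have e1 := mul_le_mul_of_nonneg_left (key1 hp hq hx hx') (Nat.cast_nonneg (α := ℝ) M)
    have e2 := mul_le_mul_of_nonneg_left (key1 hp' hq' hx hx') (Nat.cast_nonneg (α := ℝ) N)
    have e3 : loss x' {a, b} < loss x {a, b} := by
      simp only [loss_pair]
      rw [abs_of_nonpos (by linarith : x' - a ≤ 0), abs_of_nonpos (by linarith : x' - b ≤ 0),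
        abs_of_nonpos (by linarith : x - a ≤ 0), abs_of_nonpos (by linarith : x - b ≤ 0)]
      linarith
    linarith
  · simp only [loss_add, loss_nsmul]
    rw [key2 hp hq h1 h2, key2 hp hq h3 h4, key2 hp' hq' h1 h2, key2 hp' hq' h3 h4,
      key2 le_rfl le_rfl h1 h2, key2 le_rfl le_rfl h3 h4]
  · simp only [loss_add, loss_nsmul]
    have e1 := mul_le_mul_of_nonneg_left (key3 hp hq hx hx') (Nat.cast_nonneg (α := ℝ) M)
    have e2 := mul_le_mul_of_nonneg_left (key3 hp' hq' hx hx') (Nat.cast_nonneg (α := ℝ) N)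
    have e3 : loss x {a, b} < loss x' {a, b} := by
      simp only [loss_pair]
      rw [abs_of_nonneg (by linarith : 0 ≤ x' - a), abs_of_nonneg (by linarith : 0 ≤ x' - b),
        abs_of_nonneg (by linarith : 0 ≤ x - a), abs_of_nonneg (by linarith : 0 ≤ x - b)]
      linarith
    linarith

theorem pair_ne_zero (a b : ℝ) (U V : Multiset ℝ) : ({a, b} : Multiset ℝ) + U + V ≠ 0 := by
  intro h
  have := congrArg Multiset.card h
  simp at this

theorem arch (c e : ℝ) (he : 0 < e) : ∃ N : ℕ, 0 < c + N * e := by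
  obtain ⟨N, hN⟩ := exists_nat_gt (-c / e)
  refine ⟨N, ?_⟩
  rw [div_lt_iff₀ he] at hN
  linarith

theorem famH {y0 y1 s h : ℝ} (hy : y0 ≤ y1) (hs : s < y0) (hh : y1 < h) (x : ℝ)
    (hx : s < x) (hxh : x < h) : ∃ A : Multiset ℝ, A ≠ 0 ∧ IsMed (fun x => loss x A) y0 y1 ∧
      loss x A < loss h A ∧ loss h A < loss s A := by
  obtain ⟨z, hz1, hz2, hz3⟩ : ∃ z, s < z ∧ z ≤ x ∧ z ≤ y0 :=
    ⟨min x y0, lt_min hx hs, min_le_left _ _, min_le_right _ _⟩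
  obtain ⟨M, hM⟩ := arch (loss h {y0, y1} - loss z {y0, y1}) (2 * (h - y1)) (by linarith)
  obtain ⟨N, hN⟩ := arch (loss s {y0, y1} - loss h {y0, y1}
    + M * (loss s {z, y1} - loss h {z, y1})) (2 * (z - s)) (by linarith)
  have m := med_pair hy hz3 le_rfl hz3 hh.le M N
  refine ⟨_, pair_ne_zero _ _ _ _, m, ?_, ?_⟩
  · have e1 : loss z ({y0, y1} + M • {z, y1} + N • {z, h})
        < loss h ({y0, y1} + M • {z, y1} + N • {z, h}) := by
      simp only [loss_add, loss_nsmul]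
      have a1 : loss h {z, y1} - loss z {z, y1} = 2 * (h - y1) := by
        simp only [loss_pair]
        rw [abs_of_nonneg (by linarith : 0 ≤ h - z), abs_of_nonneg (by linarith : 0 ≤ h - y1),
          sub_self, abs_zero, abs_of_nonpos (by linarith : z - y1 ≤ 0)]
        ring
      have a2 : loss h {z, h} = loss z {z, h} := by
        simp only [loss_pair]
        rw [abs_sub_comm h z]; simp
      rw [← a1] at hM
      rw [a2]
      linarith
    rcases le_or_gt x y0 with h1 | h1
    · rcases hz2.lt_or_eq with h2 | h2
      · have := m.2.1 _ _ h2 h1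
        simp only at this
        linarith
      · rw [← h2]; exact e1
    · rcases le_or_gt x y1 with h2 | h2
      · have a := m.2.2.1 x y1 h1.le h2 hy le_rfl
        have b := m.2.2.2 y1 h le_rfl hh
        simp only at a b
        linarith
      · exact m.2.2.2 _ _ h2.le hxh
  · simp only [loss_add, loss_nsmul]
    have a1 : loss s {z, h} - loss h {z, h} = 2 * (z - s) := by
      simp only [loss_pair]
      rw [abs_of_nonneg (by linarith : 0 ≤ h - z), sub_self, abs_zero,
        abs_of_nonpos (by linarith : s - z ≤ 0), abs_of_nonpos (by linarith : s - h ≤ 0)]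
      ring
    rw [← a1] at hN
    linarith

theorem loss_neg (x : ℝ) (S : Multiset ℝ) : loss x (S.map (fun y => -y)) = loss (-x) S := by
  simp only [loss, Multiset.map_map, Function.comp_def]
  congr 2
  funext y
  rw [← abs_neg]
  congr 1
  ring

theorem famS {y0 y1 s h : ℝ} (hy : y0 ≤ y1) (hs : s < y0) (hh : y1 < h) (x : ℝ)
    (hx : s < x) (hxh : x < h) : ∃ A : Multiset ℝ, A ≠ 0 ∧ IsMed (fun x => loss x A) y0 y1 ∧
      loss x A < loss s A ∧ loss s A < loss h A := by
  obtain ⟨A, a1, a2, a3, a4⟩ := famH (y0 := -y1) (y1 := -y0) (s := -h) (h := -s)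
    (by linarith) (by linarith) (by linarith) (-x) (by linarith) (by linarith)
  refine ⟨A.map (fun y => -y), by simpa using a1, ?_, ?_, ?_⟩
  · have := a2.neg
    simpa [loss_neg] using this
  · simpa [loss_neg] using a3
  · simpa [loss_neg] using a4

theorem loss_diff_lower (S : Multiset ℝ) (x x' : ℝ) (hx : x ≤ x') :
    (2 * ((S.countP (· ≤ x) : ℕ) : ℝ) - S.card) * (x' - x) ≤ loss x' S - loss x S := by
  induction S using Multiset.induction_on with
  | empty => simp [loss]
  | cons a S ih =>
    have e : ∀ z, loss z (a ::ₘ S) = |z - a| + loss z S := by intro z; simp [loss]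
    rw [e, e, Multiset.countP_cons, Multiset.card_cons]
    by_cases h : a ≤ x
    · rw [if_pos h, abs_of_nonneg (by linarith : 0 ≤ x' - a), abs_of_nonneg (by linarith : 0 ≤ x - a)]
      push_cast
      linarith
    · rw [if_neg h]
      have := abs_sub_abs_le_abs_sub (x - a) (x' - a)
      rw [show x - a - (x' - a) = -(x' - x) by ring, abs_neg,
        abs_of_nonneg (by linarith : 0 ≤ x' - x)] at this
      push_cast
      linarith

theorem loss_diff_upper (S : Multiset ℝ) (x x' : ℝ) (hx : x ≤ x') :
    loss x' S - loss x S ≤ (2 * ((S.countP (· < x') : ℕ) : ℝ) - S.card) * (x' - x) := by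
  induction S using Multiset.induction_on with
  | empty => simp [loss]
  | cons a S ih =>
    have e : ∀ z, loss z (a ::ₘ S) = |z - a| + loss z S := by intro z; simp [loss]
    rw [e, e, Multiset.countP_cons, Multiset.card_cons]
    by_cases h : a < x'
    · rw [if_pos h]
      have := abs_sub_abs_le_abs_sub (x' - a) (x - a)
      rw [show x' - a - (x - a) = x' - x by ring,
        abs_of_nonneg (by linarith : 0 ≤ x' - x)] at this
      push_cast
      linarith
    · push Not at h
      rw [if_neg (not_lt.2 h), abs_of_nonpos (by linarith : x' - a ≤ 0),
        abs_of_nonpos (by linarith : x - a ≤ 0)]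
      push_cast
      linarith

theorem count_le_sorted (L : List ℝ) (hL : L.Pairwise (· ≤ ·)) (m : ℕ) (hm : m < L.length) (x : ℝ)
    (hx : L.getD m 0 ≤ x) : m + 1 ≤ L.countP (· ≤ x) := by
  have h1 : (L.take (m+1)).countP (· ≤ x) = (L.take (m+1)).length := by
    rw [List.countP_eq_length]
    intro a ha
    obtain ⟨k, hk, rfl⟩ := List.mem_iff_getElem.1 ha
    simp only [decide_eq_true_eq]
    rw [List.getElem_take]
    rw [List.getD_eq_getElem _ _ hm] at hx
    refine le_trans ?_ hx
    simp only [List.length_take] at hk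
    exact hL.rel_get_of_le (a := ⟨k, by omega⟩) (b := ⟨m, hm⟩) (by simp; omega)
  have h2 := (List.take_sublist (m+1) L).countP_le (p := (· ≤ x))
  rw [h1, List.length_take] at h2
  omega

theorem count_lt_sorted (L : List ℝ) (hL : L.Pairwise (· ≤ ·)) (m : ℕ) (hm : m < L.length) (x : ℝ)
    (hx : x ≤ L.getD m 0) : L.countP (· < x) ≤ m := by
  have h1 : (L.drop m).countP (· < x) = 0 := by
    rw [List.countP_eq_zero]
    intro a ha
    obtain ⟨k, hk, rfl⟩ := List.mem_iff_getElem.1 ha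
    simp only [decide_eq_true_eq, not_lt]
    rw [List.getElem_drop]
    rw [List.getD_eq_getElem _ _ hm] at hx
    refine le_trans hx ?_
    simp only [List.length_drop] at hk
    exact hL.rel_get_of_le (a := ⟨m, hm⟩) (b := ⟨m + k, by omega⟩) (by simp)
  have h2 := List.countP_append (p := (· < x)) (l₁ := L.take m) (l₂ := L.drop m)
  rw [List.take_append_drop, h1] at h2
  have h3 := List.countP_le_length (p := (· < x)) (l := L.take m)
  rw [List.length_take] at h3
  omega

theorem isMed_med (S : Multiset ℝ) (hS : S ≠ 0) :
    IsMed (fun x => loss x S) (medLo S) (medHi S) := by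
  have hc : 0 < S.card := Multiset.card_pos.2 hS
  have hlen : (S.sort (· ≤ ·)).length = S.card := Multiset.length_sort ..
  have hsort : (S.sort (· ≤ ·)).Pairwise (· ≤ ·) := Multiset.pairwise_sort ..
  have cnt : ∀ (p : ℝ → Prop) [DecidablePred p],
      S.countP p = (S.sort (· ≤ ·)).countP (fun a => decide (p a)) := by
    intro p _
    conv_lhs => rw [← Multiset.sort_eq S (· ≤ ·)]
    rw [Multiset.coe_countP]
  have lo_le : ∀ x, medLo S ≤ x → S.card ≤ 2 * S.countP (· ≤ x) := by
    intro x hx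
    have := count_le_sorted _ hsort ((S.card - 1) / 2) (by omega) x hx
    rw [cnt]; omega
  have hi_le : ∀ x, medHi S ≤ x → S.card < 2 * S.countP (· ≤ x) := by
    intro x hx
    have := count_le_sorted _ hsort (S.card / 2) (by omega) x hx
    rw [cnt]; omega
  have le_lo : ∀ x, x ≤ medLo S → 2 * S.countP (· < x) < S.card := by
    intro x hx
    have := count_lt_sorted _ hsort ((S.card - 1) / 2) (by omega) x hx
    rw [cnt]; omega
  have le_hi : ∀ x, x ≤ medHi S → 2 * S.countP (· < x) ≤ S.card := by
    intro x hx
    have := count_lt_sorted _ hsort (S.card / 2) (by omega) x hx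
    rw [cnt]; omega
  have hle : medLo S ≤ medHi S := by
    unfold medLo medHi
    rw [List.getD_eq_getElem _ _ (by omega : (S.card - 1) / 2 < _),
      List.getD_eq_getElem _ _ (by omega : S.card / 2 < _)]
    exact hsort.rel_get_of_le (a := ⟨(S.card - 1) / 2, by omega⟩) (b := ⟨S.card / 2, by omega⟩)
      (by simp; omega)
  have flat : ∀ x x', medLo S ≤ x → x ≤ x' → x' ≤ medHi S → loss x S = loss x' S := by
    intro x x' h1 h2 h3
    have a := loss_diff_lower S x x' h2
    have b := loss_diff_upper S x x' h2
    have c : (S.card : ℝ) ≤ 2 * (S.countP (· ≤ x) : ℕ) := by exact_mod_cast lo_le x h1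
    have d : 2 * ((S.countP (· < x') : ℕ) : ℝ) ≤ S.card := by exact_mod_cast le_hi x' h3
    nlinarith
  refine ⟨hle, fun x x' hx hx' => ?_, fun x x' h1 h2 h3 h4 => ?_, fun x x' hx hx' => ?_⟩
  · have b := loss_diff_upper S x x' hx.le
    have d : 2 * ((S.countP (· < x') : ℕ) : ℝ) < S.card := by exact_mod_cast le_lo x' hx'
    simp only
    nlinarith
  · rcases le_total x x' with h | h
    · exact flat _ _ h1 h h4
    · exact (flat _ _ h3 h h2).symm
  · have a := loss_diff_lower S x x' hx'.le
    have c : (S.card : ℝ) < 2 * (S.countP (· ≤ x) : ℕ) := by exact_mod_cast hi_le x hx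
    simp only
    nlinarith

/-- Some agent's median interval is of one of the two forms in the theorem. -/
def Bad (s h : ℝ) (S : Multiset ℝ) : Prop :=
  (medLo S ≤ s ∧ medHi S < h) ∨ (h ≤ medHi S ∧ s < medLo S)

/-- The two-output form away from ties. -/
def TwoOut (n : ℕ) (π : (Fin n → Multiset ℝ) → ℝ) (i : Fin n) (y0 y1 s h : ℝ)
    (D : Fin n → Multiset ℝ) : Prop :=
  ∀ A : Multiset ℝ, A ≠ 0 → IsMed (fun x => loss x A) y0 y1 →
    (loss s A < loss h A → π (Function.update D i A) = s) ∧
    (loss h A < loss s A → π (Function.update D i A) = h)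

theorem twoOut_step (n : ℕ) (π : (Fin n → Multiset ℝ) → ℝ)
    (hanon : Anonymous n π) (hsp : Strategyproof n π)
    (i j : Fin n) (hij : j ≠ i) (D : Fin n → Multiset ℝ) (hD : ∀ j, j ≠ i → D j ≠ 0)
    (y0 y1 s h : ℝ) (hy : y0 ≤ y1) (hs : s < y0) (hh : y1 < h)
    (P : TwoOut n π i y0 y1 s h D) (hbad : Bad s h (D j)) :
    ∃ B : Multiset ℝ, B ≠ 0 ∧ IsMed (fun x => loss x B) y0 y1 ∧
      TwoOut n π i y0 y1 s h (Function.update D j B) := by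
  have hne : ∀ A B : Multiset ℝ, A ≠ 0 → B ≠ 0 →
      ∀ k, Function.update (Function.update D j B) i A k ≠ 0 := by
    intro A B hA hB k
    by_cases h1 : k = i
    · subst h1; simpa using hA
    · rw [Function.update_of_ne h1]
      by_cases h2 : k = j
      · subst h2; simpa using hB
      · rw [Function.update_of_ne h2]; exact hD k h1
  let f : Multiset ℝ → Multiset ℝ → ℝ := fun A B =>
    π (Function.update (Function.update D j B) i A)
  have hsym : ∀ A B : Multiset ℝ, A ≠ 0 → B ≠ 0 → f A B = f B A := by
    intro A B hA hB
    have := hanon _ (hne B A hB hA) (Equiv.swap i j)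
    simp only [f]
    rw [← this]
    congr 1
    funext k
    simp only [Function.comp]
    by_cases h1 : k = i
    · subst h1; simp [hij]
    · by_cases h2 : k = j
      · subst h2; simp [hij]
      · rw [Equiv.swap_apply_of_ne_of_ne h1 h2]
        simp [h1, h2]
  have hsp' : ∀ A B B' : Multiset ℝ, A ≠ 0 → B ≠ 0 → B' ≠ 0 →
      loss (f A B) B ≤ loss (f A B') B := by
    intro A B B' hA hB hB'
    have := hsp j _ (hne A B hA hB) B' hB'
    rw [Function.update_comm hij.symm, Function.update_idem, Function.update_comm hij,
      Function.update_self, Function.update_comm hij.symm A B D] at this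
    exact this
  have hd := hD j hij
  have md := isMed_med _ hd
  have hfd : ∀ A, f A (D j) = π (Function.update D i A) := by
    intro A; simp [f]
  rcases hbad with ⟨b1, b2⟩ | ⟨b1, b2⟩
  · obtain ⟨B, hB, mB, -, sB⟩ := famS hy hs hh y0 hs (by linarith)
    refine ⟨B, hB, mB, ?_⟩
    refine step loss (fun A => A ≠ 0) f hsym hsp' y0 y1 s h hs hh (D j) hd ?_ ?_
      (famH hy hs hh) B hB mB sB
    · intro x hx hxh
      rcases le_total x (medHi (D j)) with h1 | h1
      · have a := md.2.2.1 x (medHi (D j)) (by linarith) h1 md.1 le_rfl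
        have b := md.2.2.2 _ _ le_rfl b2
        simp only at a b
        linarith
      · exact md.2.2.2 _ _ h1 hxh
    · intro A hA mA
      rw [hfd]; exact P A hA mA
  · obtain ⟨B, hB, mB, -, sB⟩ := famH hy hs hh y0 hs (by linarith)
    refine ⟨B, hB, mB, ?_⟩
    have key := step (fun x S => loss (-x) S) (fun A => A ≠ 0) (fun A B => - f A B)
      (fun A B hA hB => by rw [hsym A B hA hB])
      (fun A B B' hA hB hB' => by simpa using hsp' A B B' hA hB hB')
      (-y1) (-y0) (-h) (-s) (by linarith) (by linarith) (D j) hd ?_ ?_ ?_ B hB mB.neg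
      (by simpa using sB)
    · intro A hA mA
      obtain ⟨k1, k2⟩ := key A hA mA.neg
      simp only [neg_neg, neg_inj] at k1 k2
      exact ⟨k2, k1⟩
    · intro x hx hxh
      simp only [neg_neg]
      rcases le_total (medLo (D j)) (-x) with h1 | h1
      · have a := md.2.2.1 (-x) (medLo (D j)) h1 (by linarith) le_rfl md.1
        have b := md.2.1 _ _ b2 le_rfl
        simp only at a b
        linarith
      · exact md.2.1 _ _ (by linarith) h1
    · intro A hA mA
      have mA' := mA.neg
      simp only [neg_neg] at mA' ⊢
      rw [hfd, neg_inj, neg_inj]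
      exact (P A hA mA').symm
    · intro x hx hxh
      obtain ⟨A, a1, a2, a3, a4⟩ := famS hy hs hh (-x) (by linarith) (by linarith)
      exact ⟨A, a1, a2.neg, by simpa using a3, by simpa using a4⟩

theorem not_twoOut (n : ℕ) (π : (Fin n → Multiset ℝ) → ℝ)
    (hanon : Anonymous n π) (heff : Efficient n π) (hsp : Strategyproof n π)
    (i : Fin n) (y0 y1 s h : ℝ) (hy : y0 ≤ y1) (hs : s < y0) (hh : y1 < h) (N : ℕ) :
    ∀ D : Fin n → Multiset ℝ, (∀ j, j ≠ i → D j ≠ 0) →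
      {j | j ≠ i ∧ Bad s h (D j)}.ncard = N → ¬ TwoOut n π i y0 y1 s h D := by
  induction N with
  | zero =>
    intro D hD hN P
    rw [Set.ncard_eq_zero] at hN
    obtain ⟨B, hB, mB, -, sB⟩ := famS hy hs hh y0 hs (by linarith)
    have pB := (P B hB mB).1 sB
    have hne : ∀ k, Function.update D i B k ≠ 0 := by
      intro k
      by_cases h1 : k = i
      · subst h1; simpa using hB
      · rw [Function.update_of_ne h1]; exact hD k h1
    have hev : ∀ k, ∀ᶠ x in nhdsWithin s (Set.Ioi s),
        loss x (Function.update D i B k) ≤ loss s (Function.update D i B k) := by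
      intro k
      by_cases h1 : k = i
      · subst h1
        filter_upwards [Ioo_mem_nhdsGT hs] with x hx
        rw [Function.update_self]
        exact (mB.2.1 _ _ hx.1 hx.2.le).le
      · rw [Function.update_of_ne h1]
        have md := isMed_med _ (hD k h1)
        have nb : ¬ Bad s h (D k) := fun hb => by
          have : k ∈ {j | j ≠ i ∧ Bad s h (D j)} := ⟨h1, hb⟩
          rw [hN] at this
          exact this
        unfold Bad at nb
        push Not at nb
        rcases le_or_gt (medLo (D k)) s with h2 | h2
        · have h3 := nb.1 h2
          filter_upwards [Ioo_mem_nhdsGT (show s < h by linarith)] with x hx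
          exact (md.2.2.1 x s (by linarith [hx.1]) (by linarith [hx.2]) h2 (by linarith)).le
        · filter_upwards [Ioo_mem_nhdsGT h2] with x hx
          exact (md.2.1 _ _ hx.1 hx.2.le).le
    obtain ⟨x, hx1, hx2⟩ := ((Filter.eventually_all.2 hev).and (Ioo_mem_nhdsGT hs)).exists
    apply heff _ hne
    refine ⟨x, ?_, i, ?_⟩
    · rw [pB]; exact hx1
    · rw [pB, Function.update_self]
      exact mB.2.1 _ _ hx2.1 hx2.2.le
  | succ N ih =>
    intro D hD hN P
    have hnon : {j | j ≠ i ∧ Bad s h (D j)}.Nonempty := by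
      rw [← Set.ncard_pos]; omega
    obtain ⟨j, hij, hbad⟩ := hnon
    obtain ⟨B, hB, mB, PB⟩ := twoOut_step n π hanon hsp i j hij D hD y0 y1 s h hy hs hh P hbad
    refine ih (Function.update D j B) ?_ ?_ PB
    · intro k hk
      by_cases h2 : k = j
      · subst h2; simpa using hB
      · rw [Function.update_of_ne h2]; exact hD k hk
    · have : {k | k ≠ i ∧ Bad s h (Function.update D j B k)}
          = {k | k ≠ i ∧ Bad s h (D k)} \ {j} := by
        ext k
        simp only [Set.mem_setOf_eq, Set.mem_diff, Set.mem_singleton_iff]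
        by_cases h2 : k = j
        · subst h2
          have u := (isMed_med B hB).unique mB
          simp only [Function.update_self, not_true, and_false, iff_false, not_and]
          intro _ hb
          unfold Bad at hb
          rw [u.1, u.2] at hb
          rcases hb with hb | hb <;> linarith [hb.1, hb.2]
        · simp [h2]
      rw [this, Set.ncard_diff_singleton_of_mem (show j ∈ {k | k ≠ i ∧ Bad s h (D k)} from ⟨hij, hbad⟩), hN]
      rfl

/-- Lemma 4 of the paper: if an anonymous, efficient, strategyproof
mechanism has the two-output form of Eqn. (4) with `s < y0 ≤ y1 < h` for agent `i`,
then no other agent's median interval `[y_j^0,y_j^1]` satisfies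
`(y_j^0 ≤ s ∧ y_j^1 < h)` or `(y_j^1 ≥ h ∧ y_j^0 > s)`
(and agent `i`'s interval `[y0,y1]` trivially satisfies neither). -/
theorem stmt_4 (n : ℕ) (π : (Fin n → Multiset ℝ) → ℝ)
    (hanon : Anonymous n π) (heff : Efficient n π) (hsp : Strategyproof n π)
    (i : Fin n) (D : Fin n → Multiset ℝ) (hD : ∀ j, j ≠ i → D j ≠ 0)
    (y0 y1 s h : ℝ) (hy : y0 ≤ y1) (hs : s < y0) (hh : y1 < h)
    (heqn : ∀ Di : Multiset ℝ, Di ≠ 0 → medLo Di = y0 → medHi Di = y1 →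
        (loss s Di < loss h Di → π (Function.update D i Di) = s) ∧
        (loss h Di < loss s Di → π (Function.update D i Di) = h) ∧
        (loss s Di = loss h Di →
          π (Function.update D i Di) = s ∨ π (Function.update D i Di) = h)) :
    (∀ j : Fin n, j ≠ i → ¬(medLo (D j) ≤ s ∧ medHi (D j) < h)) ∧
    (∀ j : Fin n, j ≠ i → ¬(h ≤ medHi (D j) ∧ s < medLo (D j))) := by
  exfalso
  refine not_twoOut n π hanon heff hsp i y0 y1 s h hy hs hh _ D hD rfl ?_
  intro A hA mA
  have u := (isMed_med A hA).unique mA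
  obtain ⟨k1, k2, -⟩ := heqn A hA u.1 u.2
  exact ⟨k1, k2⟩
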